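/- Let p be a prime, let η be a Lévy measure on the p-adic solenoid S_p, and for n ≥ 0 let η_{n+1} be the Lévy measure on ℝ × ℤⁿ induced via τ (η_{n+1}({0}) = 0 and η_{n+1}(B × {ℓ}) = η({x ∈ S_p : τ(x)_0 ∈ B, (τ(x)_1,…,τ(x)_n) = ℓ})). Then for every n ≥ 0, y ∈ ℝ and z_1, …, z_n ∈ 𝕋, ∫_{ℝ×ℤ^{n+1}} (e^{iyx} z_1^{ℓ_1} ⋯ z_n^{ℓ_n} − 1 − iy h(x)) dη_{n+2}(x, ℓ_1, …, ℓ_{n+1}) = ∫_{ℝ×ℤⁿ} (e^{iyx} z_1^{ℓ_1} ⋯ z_n^{ℓ_n} − 1 − iy h(x)) dη_{n+1}(x, ℓ_1, …, ℓ_n), both sides being equal to the finite integral ∫_{S_p} (e^{iy·arg x_0} z_1^{(p·arg x_1 − arg x_0)/(2π)} ⋯ z_n^{(p·arg x_n − arg x_{n−1})/(2π)} − 1 − iy h(arg x_0)) dη(x); in particular this common integral is finite. -/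

import Mathlib

open MeasureTheory Real Complex ENNReal

noncomputable instance : MeasurableSpace Circle := borel Circle
instance : BorelSpace Circle := ⟨rfl⟩

/-- The `p`-adic solenoid, as a subgroup of the product `𝕋^{ℕ}` of circle groups. -/
noncomputable def Sp (p : ℕ) : Subgroup (ℕ → Circle) where
  carrier := {y | ∀ j : ℕ, y j = y (j + 1) ^ p}
  one_mem' := by intro j; simp
  mul_mem' := by
    intro a b ha hb j
    simp only [Pi.mul_apply, mul_pow]
    rw [← ha j, ← hb j]
  inv_mem' := by
    intro a ha j
    simp only [Pi.inv_apply, inv_pow]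
    rw [← ha j]

/-- The function `h` used as (the kernel of) the local inner product. -/
noncomputable def hFun (x : ℝ) : ℝ :=
  if x < -π then 0
  else if π ≤ x then 0
  else if x < -(π / 2) then -x - π
  else if x < π / 2 then x
  else -x + π

lemma abs_hFun_le (x : ℝ) : |hFun x| ≤ π := by
  have := pi_pos
  unfold hFun
  split_ifs <;> rw [abs_le] <;> constructor <;> linarith

lemma hFun_of_abs_lt {x : ℝ} (hx : |x| < π / 2) : hFun x = x := by
  have := pi_pos
  rw [abs_lt] at hx
  unfold hFun
  split_ifs <;> linarith

lemma measurable_hFun : Measurable hFun := by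
  unfold hFun
  refine Measurable.ite measurableSet_Iio measurable_const
    (Measurable.ite measurableSet_Ici measurable_const
      (Measurable.ite measurableSet_Iio ?_ (Measurable.ite measurableSet_Iio ?_ ?_))) <;> fun_prop

/-- The argument of the `j`-th coordinate of a point of the solenoid. -/
noncomputable def coordArg {p : ℕ} (j : ℕ) (x : ↥(Sp p)) : ℝ :=
  Complex.arg (((x : ℕ → Circle) j : Circle) : ℂ)

/-- The integer `(p · arg x_{j+1} − arg x_j) / (2π)`. -/
noncomputable def winding {p : ℕ} (j : ℕ) (x : ↥(Sp p)) : ℤ :=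
  ⌊(p * coordArg (j + 1) x - coordArg j x) / (2 * π)⌋

lemma winding_eq {p : ℕ} (j : ℕ) (x : ↥(Sp p)) :
    (winding j x : ℝ) = (p * coordArg (j + 1) x - coordArg j x) / (2 * π) := by
  have h : Circle.exp (p * coordArg (j + 1) x) = Circle.exp (coordArg j x) := by
    rw [← nsmul_eq_mul, Circle.exp_nsmul]
    simp only [coordArg, Circle.exp_arg]
    exact (x.2 j).symm
  obtain ⟨m, hm⟩ := Circle.exp_eq_exp.1 h
  have hm' : (p * coordArg (j + 1) x - coordArg j x) / (2 * π) = m := by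
    rw [hm]
    field_simp
    ring
  rw [winding, hm', Int.floor_intCast]

lemma eq_winding_iff {p : ℕ} (j : ℕ) (x : ↥(Sp p)) (m : ℤ) :
    (m : ℝ) * (2 * π) = p * coordArg (j + 1) x - coordArg j x ↔ winding j x = m := by
  rw [← Int.cast_inj (α := ℝ), winding_eq, div_eq_iff two_pi_pos.ne', eq_comm]

lemma measurable_coordArg {p : ℕ} (j : ℕ) : Measurable (coordArg (p := p) j) := by
  have h1 : Measurable fun u : Circle => (u : ℂ) := by fun_prop
  have h2 : Measurable fun x : ↥(Sp p) => (x : ℕ → Circle) j :=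
    (measurable_pi_apply j).comp measurable_subtype_coe
  exact Complex.measurable_arg.comp (h1.comp h2)

lemma measurable_winding {p : ℕ} (j : ℕ) : Measurable (winding (p := p) j) :=
  Int.measurable_floor.comp <|
    (((measurable_coordArg (j + 1)).const_mul _).sub (measurable_coordArg j)).div_const _

lemma coordArg_one {p : ℕ} (j : ℕ) : coordArg j (1 : ↥(Sp p)) = 0 := by simp [coordArg]

lemma continuousAt_coordArg_one {p : ℕ} (j : ℕ) :
    ContinuousAt (coordArg (p := p) j) (1 : ↥(Sp p)) := by
  refine ContinuousAt.comp (g := Complex.arg) (Complex.continuousAt_arg (by simp)) ?_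
  have h : Continuous fun u : Circle => (u : ℂ) := by fun_prop
  exact (h.comp
    ((continuous_apply j).comp continuous_subtype_val)).continuousAt

/-- The first `n + 1` coordinates of `τ`. -/
noncomputable def tauTrunc {p : ℕ} (n : ℕ) (x : ↥(Sp p)) : ℝ × (Fin n → ℤ) :=
  (coordArg 0 x, fun i => winding i x)

lemma measurable_tauTrunc {p : ℕ} (n : ℕ) : Measurable (tauTrunc (p := p) n) :=
  (measurable_coordArg 0).prodMk (measurable_pi_lambda _ fun _ => measurable_winding _)

/-- Two measures on `α × β` with `β` countable agree on a measurable set as soon as they agree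
on the measurable rectangles with singleton second factor contained in it. -/
lemma restrict_eq_of_prod_singleton {α β : Type*} [MeasurableSpace α] [MeasurableSpace β]
    [Countable β] [MeasurableSingletonClass β] {μ ν : Measure (α × β)} {A : Set (α × β)}
    (hA : MeasurableSet A)
    (h : ∀ B : Set α, MeasurableSet B → ∀ b, B ×ˢ ({b} : Set β) ⊆ A →
      μ (B ×ˢ {b}) = ν (B ×ˢ {b})) :
    μ.restrict A = ν.restrict A := by
  ext s hs
  rw [Measure.restrict_apply hs, Measure.restrict_apply hs]
  set S := s ∩ A
  have hS : MeasurableSet S := hs.inter hA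
  have hB (b : β) : MeasurableSet {a | (a, b) ∈ S} := measurable_prodMk_right hS
  have hU : S = ⋃ b, {a | (a, b) ∈ S} ×ˢ ({b} : Set β) := by
    ext ⟨a, b⟩
    simp
  have hd : Pairwise (Function.onFun Disjoint fun b => {a | (a, b) ∈ S} ×ˢ ({b} : Set β)) :=
    fun b c hbc => Set.disjoint_prod.2 (Or.inr (by simpa using hbc))
  rw [hU, measure_iUnion hd fun b => (hB b).prod (measurableSet_singleton b),
    measure_iUnion hd fun b => (hB b).prod (measurableSet_singleton b)]
  refine tsum_congr fun b => h _ (hB b) b ?_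
  rintro ⟨a, c⟩ ⟨ha, rfl⟩
  exact ha.2

lemma integral_eq_integral_comp_tauTrunc {p n : ℕ} {η : Measure ↥(Sp p)}
    {ν : Measure (ℝ × (Fin n → ℤ))}
    (hν : ∀ B : Set ℝ, MeasurableSet B → ∀ ℓ : Fin n → ℤ, ¬((0 : ℝ) ∈ B ∧ ℓ = 0) →
      ν (B ×ˢ ({ℓ} : Set (Fin n → ℤ))) = η (tauTrunc n ⁻¹' (B ×ˢ {ℓ})))
    {f : ℝ × (Fin n → ℤ) → ℂ} (hf : Measurable f) (hf0 : f 0 = 0) :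
    ∫ q, f q ∂ν = ∫ x, f (tauTrunc n x) ∂η := by
  have hA : MeasurableSet ({0}ᶜ : Set (ℝ × (Fin n → ℤ))) := (measurableSet_singleton 0).compl
  have key : ν.restrict {0}ᶜ = (η.map (tauTrunc n)).restrict {0}ᶜ := by
    refine restrict_eq_of_prod_singleton hA fun B hB ℓ hsub => ?_
    rw [Measure.map_apply (measurable_tauTrunc n) (hB.prod (measurableSet_singleton ℓ))]
    refine hν B hB ℓ ?_
    rintro ⟨h0, rfl⟩
    exact hsub (Set.mk_mem_prod h0 (Set.mem_singleton _)) rfl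
  have hz : ∀ q ∉ ({0}ᶜ : Set (ℝ × (Fin n → ℤ))), f q = 0 := by
    intro q hq
    rw [Set.mem_compl_iff, not_not, Set.mem_singleton_iff] at hq
    rw [hq, hf0]
  rw [← integral_map (measurable_tauTrunc n).aemeasurable hf.aestronglyMeasurable,
    ← setIntegral_eq_integral_of_forall_compl_eq_zero hz, key,
    setIntegral_eq_integral_of_forall_compl_eq_zero hz]

/-- The generalized Poisson integrand on `ℝ × ℤⁿ`. -/
noncomputable def poissonIntegrand {n : ℕ} (y : ℝ) (z : Fin n → Circle)
    (q : ℝ × (Fin n → ℤ)) : ℂ :=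
  Complex.exp (Complex.I * y * q.1) * ∏ k : Fin n, ((z k : ℂ)) ^ (q.2 k)
    - 1 - Complex.I * y * hFun q.1

lemma measurable_poissonIntegrand {n : ℕ} (y : ℝ) (z : Fin n → Circle) :
    Measurable (poissonIntegrand y z) := by
  have h1 : Measurable fun q : ℝ × (Fin n → ℤ) => hFun q.1 := measurable_hFun.comp measurable_fst
  have h2 (k : Fin n) : Measurable fun q : ℝ × (Fin n → ℤ) => (z k : ℂ) ^ (q.2 k) :=
    (measurable_from_top (f := fun m : ℤ => (z k : ℂ) ^ m)).comp
      ((measurable_pi_apply k).comp measurable_snd)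
  unfold poissonIntegrand
  fun_prop

lemma poissonIntegrand_zero {n : ℕ} (y : ℝ) (z : Fin n → Circle) :
    poissonIntegrand y z 0 = 0 := by
  have h : hFun 0 = 0 := hFun_of_abs_lt (by simpa using pi_pos)
  simp [poissonIntegrand, h]

lemma norm_poissonIntegrand_le {n : ℕ} (y : ℝ) (z : Fin n → Circle) (q : ℝ × (Fin n → ℤ)) :
    ‖poissonIntegrand y z q‖ ≤ 2 + |y| * π := by
  have h1 : ‖Complex.exp (Complex.I * y * q.1) * ∏ k : Fin n, ((z k : ℂ)) ^ (q.2 k)‖ = 1 := by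
    have : Complex.I * y * q.1 = ((y * q.1 : ℝ) : ℂ) * Complex.I := by push_cast; ring
    rw [norm_mul, this, Complex.norm_exp_ofReal_mul_I]
    simp [norm_prod, norm_zpow, Circle.norm_coe]
  have h2 : ‖Complex.I * y * hFun q.1‖ ≤ |y| * π := by
    simpa using mul_le_mul_of_nonneg_left (abs_hFun_le q.1) (abs_nonneg y)
  calc _ ≤ ‖Complex.exp (Complex.I * y * q.1) * ∏ k : Fin n, ((z k : ℂ)) ^ (q.2 k)‖ + ‖(1 : ℂ)‖
        + ‖Complex.I * y * hFun q.1‖ :=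
        (norm_sub_le _ _).trans (add_le_add_left (norm_sub_le _ _) _)
    _ ≤ 2 + |y| * π := by rw [h1, norm_one]; linarith

lemma norm_poissonIntegrand_le_sq {n : ℕ} (y : ℝ) (z : Fin n → Circle) {q : ℝ × (Fin n → ℤ)}
    (hq : q.2 = 0) (hπ : |q.1| < π / 2) (hy : |y * q.1| < 1) :
    ‖poissonIntegrand y z q‖ ≤ y ^ 2 * q.1 ^ 2 := by
  have hn : ‖Complex.I * y * q.1‖ = |y * q.1| := by simp [abs_mul]
  have := Complex.norm_exp_sub_one_sub_id_le (x := Complex.I * y * q.1) (hn.le.trans hy.le)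
  rw [hn, sq_abs, mul_pow] at this
  simpa [poissonIntegrand, hq, hFun_of_abs_lt hπ] using this

lemma integrable_poissonIntegrand_tauTrunc {p : ℕ} {η : Measure ↥(Sp p)}
    (hηnbhd : ∀ U : Set ↥(Sp p), MeasurableSet U → U ∈ nhds (1 : ↥(Sp p)) → η Uᶜ < ⊤)
    (hηarg : ∫⁻ x : ↥(Sp p), ENNReal.ofReal (coordArg 0 x ^ 2) ∂η < ⊤)
    {n : ℕ} (y : ℝ) (z : Fin n → Circle) :
    Integrable (fun x => poissonIntegrand y z (tauTrunc n x)) η := by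
  have hm0 : Measurable (coordArg (p := p) 0) := measurable_coordArg 0
  let V (k : Fin n) : Set ↥(Sp p) := {x | |p * coordArg (k + 1) x - coordArg k x| < 2 * π}
  let U : Set ↥(Sp p) :=
    {x | |coordArg 0 x| < π / 2} ∩ {x | |y * coordArg 0 x| < 1} ∩ ⋂ k, V k
  have hVm (k : Fin n) : MeasurableSet (V k) :=
    measurableSet_lt (((measurable_coordArg (k + 1)).const_mul _).sub
      (measurable_coordArg k)).norm measurable_const
  have hUm : MeasurableSet U :=
    ((measurableSet_lt hm0.norm measurable_const).inter
      (measurableSet_lt (hm0.const_mul y).norm measurable_const)).inter (MeasurableSet.iInter hVm)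
  have hc (j : ℕ) := continuousAt_coordArg_one (p := p) j
  have hUn : U ∈ nhds (1 : ↥(Sp p)) := by
    refine Filter.inter_mem (Filter.inter_mem ?_ ?_) (Filter.iInter_mem.2 fun k => ?_)
    · exact (hc 0).abs.eventually_lt continuousAt_const (by simp [coordArg_one, pi_pos])
    · exact ((hc 0).const_mul y).abs.eventually_lt continuousAt_const (by simp [coordArg_one])
    · exact (((hc (k + 1)).const_mul (p : ℝ)).sub (hc k)).abs.eventually_lt continuousAt_const
        (by simp [coordArg_one, pi_pos])
  have hsq : Integrable (fun x : ↥(Sp p) => coordArg 0 x ^ 2) η := by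
    refine ⟨(hm0.pow_const 2).aestronglyMeasurable, ?_⟩
    rwa [hasFiniteIntegral_iff_ofReal (Filter.Eventually.of_forall fun x => sq_nonneg _)]
  have hind : Integrable (Uᶜ.indicator fun _ : ↥(Sp p) => 2 + |y| * π) η :=
    (integrable_indicator_iff hUm.compl).2 (integrableOn_const (hηnbhd U hUm hUn).ne)
  refine (hind.add (hsq.const_mul (y ^ 2))).mono'
    ((measurable_poissonIntegrand y z).comp (measurable_tauTrunc n)).aestronglyMeasurable
    (Filter.Eventually.of_forall fun x => ?_)
  rw [Pi.add_apply]
  by_cases hx : x ∈ U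
  · rw [Set.indicator_of_notMem (by simpa using hx), zero_add]
    obtain ⟨⟨hx1, hx2⟩, hx3⟩ := hx
    refine norm_poissonIntegrand_le_sq y z (q := tauTrunc n x) ?_ hx1 hx2
    funext k
    have hk : |p * coordArg (k + 1) x - coordArg k x| < 2 * π := Set.mem_iInter.1 hx3 k
    have hw : |(winding k x : ℝ)| < 1 := by
      rwa [winding_eq, abs_div, abs_of_pos two_pi_pos, div_lt_one two_pi_pos]
    exact Int.abs_lt_one_iff.1 (by exact_mod_cast hw)
  · rw [Set.indicator_of_mem (by simpa using hx)]
    have := norm_poissonIntegrand_le y z (tauTrunc n x)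
    have h2 : 0 ≤ y ^ 2 * coordArg 0 x ^ 2 := by positivity
    linarith

lemma poissonIntegrand_tauTrunc {p n : ℕ} (y : ℝ) (z : Fin n → Circle) (x : ↥(Sp p)) :
    poissonIntegrand y z (tauTrunc n x)
      = Complex.exp (Complex.I * y * Complex.arg (((x : ℕ → Circle) 0 : Circle) : ℂ))
          * ∏ k : Fin n, ((z k : ℂ))
              ^ ((((p * Complex.arg (((x : ℕ → Circle) (k + 1) : Circle) : ℂ)
                  - Complex.arg (((x : ℕ → Circle) k : Circle) : ℂ)) / (2 * π) : ℝ)) : ℂ)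
        - 1 - Complex.I * y * hFun (Complex.arg (((x : ℕ → Circle) 0 : Circle) : ℂ)) := by
  have h (k : Fin n) : ((z k : ℂ))
      ^ ((((p * Complex.arg (((x : ℕ → Circle) (k + 1) : Circle) : ℂ)
        - Complex.arg (((x : ℕ → Circle) k : Circle) : ℂ)) / (2 * π) : ℝ)) : ℂ)
      = (z k : ℂ) ^ winding k x := by
    have := winding_eq (k : ℕ) x
    simp only [coordArg] at this
    rw [← this, Complex.ofReal_intCast, Complex.cpow_intCast]
  simp only [h]
  rfl

/-- Compatibility of the generalized Poisson integrands for the measures `η_{n+1}` on `ℝ × ℤⁿ`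
induced from a Lévy measure `η` on the `p`-adic solenoid via `τ`: for all `y ∈ ℝ` and
`z_1, …, z_n ∈ 𝕋`, the integral of
`e^{iyx} z_1^{ℓ_1} ⋯ z_n^{ℓ_n} − 1 − iy h(x)` against `η_{n+2}` equals its integral against
`η_{n+1}`, both being equal to the finite integral over `S_p` of
`e^{iy·arg x_0} z_1^{(p·arg x_1 − arg x_0)/(2π)} ⋯ z_n^{(p·arg x_n − arg x_{n−1})/(2π)}
− 1 − iy h(arg x_0)`. -/
theorem stmt19 (p : ℕ) (hp : p.Prime) (η : Measure ↥(Sp p))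
    (hη1 : η {(1 : ↥(Sp p))} = 0)
    (hηnbhd : ∀ U : Set ↥(Sp p), MeasurableSet U → U ∈ nhds (1 : ↥(Sp p)) → η Uᶜ < ⊤)
    (hηarg : ∫⁻ x : ↥(Sp p),
        ENNReal.ofReal ((Complex.arg (((x : ℕ → Circle) 0 : Circle) : ℂ)) ^ 2) ∂η < ⊤)
    (ν : (n : ℕ) → Measure (ℝ × (Fin n → ℤ)))
    (hν0 : ∀ n, ν n {(0 : ℝ × (Fin n → ℤ))} = 0)
    (hν : ∀ n, ∀ B : Set ℝ, MeasurableSet B → ∀ ℓ : Fin n → ℤ, ¬((0 : ℝ) ∈ B ∧ ℓ = 0) →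
      ν n (B ×ˢ ({ℓ} : Set (Fin n → ℤ)))
        = η {x : ↥(Sp p) | Complex.arg (((x : ℕ → Circle) 0 : Circle) : ℂ) ∈ B ∧
            ∀ i : Fin n, (ℓ i : ℝ) * (2 * π)
              = p * Complex.arg (((x : ℕ → Circle) (i + 1) : Circle) : ℂ)
                - Complex.arg (((x : ℕ → Circle) i : Circle) : ℂ)}) :
    ∀ n : ℕ, ∀ y : ℝ, ∀ z : Fin n → Circle,
      (∫ q : ℝ × (Fin (n + 1) → ℤ),
          (Complex.exp (Complex.I * y * q.1) * ∏ k : Fin n, ((z k : ℂ)) ^ (q.2 k.castSucc)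
            - 1 - Complex.I * y * hFun q.1) ∂(ν (n + 1)))
        = (∫ q : ℝ × (Fin n → ℤ),
            (Complex.exp (Complex.I * y * q.1) * ∏ k : Fin n, ((z k : ℂ)) ^ (q.2 k)
              - 1 - Complex.I * y * hFun q.1) ∂(ν n)) ∧
      (∫ q : ℝ × (Fin n → ℤ),
          (Complex.exp (Complex.I * y * q.1) * ∏ k : Fin n, ((z k : ℂ)) ^ (q.2 k)
            - 1 - Complex.I * y * hFun q.1) ∂(ν n))
        = (∫ x : ↥(Sp p),
            (Complex.exp (Complex.I * y * Complex.arg (((x : ℕ → Circle) 0 : Circle) : ℂ))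
                * ∏ k : Fin n, ((z k : ℂ))
                    ^ ((((p * Complex.arg (((x : ℕ → Circle) (k + 1) : Circle) : ℂ)
                        - Complex.arg (((x : ℕ → Circle) k : Circle) : ℂ)) / (2 * π) : ℝ)) : ℂ)
              - 1
              - Complex.I * y * hFun (Complex.arg (((x : ℕ → Circle) 0 : Circle) : ℂ))) ∂η) ∧
      Integrable (fun x : ↥(Sp p) =>
          Complex.exp (Complex.I * y * Complex.arg (((x : ℕ → Circle) 0 : Circle) : ℂ))
              * ∏ k : Fin n, ((z k : ℂ))
                  ^ ((((p * Complex.arg (((x : ℕ → Circle) (k + 1) : Circle) : ℂ)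
                      - Complex.arg (((x : ℕ → Circle) k : Circle) : ℂ)) / (2 * π) : ℝ)) : ℂ)
            - 1
            - Complex.I * y * hFun (Complex.arg (((x : ℕ → Circle) 0 : Circle) : ℂ))) η := by
  intro n y z
  have hν' (m : ℕ) (B : Set ℝ) (hB : MeasurableSet B) (ℓ : Fin m → ℤ)
      (h : ¬((0 : ℝ) ∈ B ∧ ℓ = 0)) :
      ν m (B ×ˢ ({ℓ} : Set (Fin m → ℤ))) = η (tauTrunc m ⁻¹' (B ×ˢ {ℓ})) := by
    rw [hν m B hB ℓ h]
    congr 1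
    ext x
    simp only [tauTrunc, Set.mem_ofPred_eq, Set.mem_preimage, Set.mem_prod, Set.mem_singleton_iff,
      funext_iff]
    exact and_congr Iff.rfl (forall_congr' fun i => eq_winding_iff i x (ℓ i))
  let r (q : ℝ × (Fin (n + 1) → ℤ)) : ℝ × (Fin n → ℤ) := (q.1, fun k => q.2 k.castSucc)
  have hr : Measurable r := by fun_prop
  have hn := integral_eq_integral_comp_tauTrunc (hν' n) (measurable_poissonIntegrand y z)
    (poissonIntegrand_zero y z)
  have hsucc := integral_eq_integral_comp_tauTrunc (hν' (n + 1))
    ((measurable_poissonIntegrand y z).comp hr) (poissonIntegrand_zero y z)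
  simp only [← poissonIntegrand_tauTrunc]
  exact ⟨hsucc.trans hn.symm, hn, integrable_poissonIntegrand_tauTrunc hηnbhd hηarg y z⟩
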